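/- For all real t and all real x with −π/2 < x < π/2, the series ∑_{k=1}^{∞} ln( ((k − 1/2)²π² + t²) / ( ((k − 1/2)π − x)((k − 1/2)π + x) ) ) converges and its sum equals ln( cosh t / cos x ). -/

import Mathlib

open Filter Real Topology

/-- Splitting the sine product at `2w` into its even- and odd-indexed factors. -/
theorem prod_range_two_mul_sine_factor (w : ℂ) (N : ℕ) :
    ∏ j ∈ Finset.range (2 * N), (1 - (2 * w) ^ 2 / ((j : ℂ) + 1) ^ 2) =
      (∏ j ∈ Finset.range N, (1 - w ^ 2 / ((j : ℂ) + 1) ^ 2)) *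
        ∏ j ∈ Finset.range N, (1 - w ^ 2 / ((j : ℂ) + 1 / 2) ^ 2) := by
  induction N with
  | zero => simp
  | succ N ih =>
    have h1 : (N : ℂ) + 1 ≠ 0 := Nat.cast_add_one_ne_zero N
    have h2 : 2 * (N : ℂ) + 1 ≠ 0 := by exact_mod_cast Nat.succ_ne_zero (2 * N)
    have hodd : (1 : ℂ) - (2 * w) ^ 2 / (((2 * N : ℕ) : ℂ) + 1) ^ 2 =
        1 - w ^ 2 / ((N : ℂ) + 1 / 2) ^ 2 := by
      have h : (N : ℂ) + 1 / 2 = (2 * N + 1) / 2 := by ring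
      rw [h]
      push_cast
      field_simp
    have heven : (1 : ℂ) - (2 * w) ^ 2 / (((2 * N + 1 : ℕ) : ℂ) + 1) ^ 2 =
        1 - w ^ 2 / ((N : ℂ) + 1) ^ 2 := by
      have h : ((2 * N + 1 : ℕ) : ℂ) + 1 = 2 * (N + 1) := by push_cast; ring
      rw [h]
      field_simp
    rw [show 2 * (N + 1) = 2 * N + 1 + 1 by ring, Finset.prod_range_succ,
      Finset.prod_range_succ, ih, hodd, heven, Finset.prod_range_succ, Finset.prod_range_succ]
    ring

/-- Euler's product for the cosine, away from the nonzero multiples of `π`. -/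
theorem tendsto_euler_cos_prod {z : ℂ} (hz : z = 0 ∨ Complex.sin z ≠ 0) :
    Tendsto (fun N : ℕ => ∏ j ∈ Finset.range N, (1 - (z / π) ^ 2 / ((j : ℂ) + 1 / 2) ^ 2))
      atTop (𝓝 (Complex.cos z)) := by
  rcases hz with rfl | hs
  · simp
  have hpi : (π : ℂ) ≠ 0 := Complex.ofReal_ne_zero.mpr pi_ne_zero
  have hzpi : (π : ℂ) * (z / π) = z := mul_div_cancel₀ z hpi
  have hsin := Complex.tendsto_euler_sin_prod (z / π)
  have hsin2 := (Complex.tendsto_euler_sin_prod (2 * (z / π))).comp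
    (tendsto_id.const_mul_atTop' (two_pos : (0 : ℕ) < 2))
  rw [hzpi] at hsin
  rw [show (π : ℂ) * (2 * (z / π)) = 2 * z by rw [mul_left_comm, hzpi]] at hsin2
  have hquot := hsin2.div (hsin.const_mul 2) (mul_ne_zero two_ne_zero hs)
  rw [Complex.sin_two_mul, mul_div_cancel_left₀ _ (mul_ne_zero two_ne_zero hs)] at hquot
  refine hquot.congr' ?_
  filter_upwards [hsin.eventually_ne hs] with N hN
  simp only [Function.comp_apply, id_eq, Pi.div_apply, prod_range_two_mul_sine_factor]
  rw [div_eq_iff (mul_ne_zero two_ne_zero hN)]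
  ring

theorem born_infeld_factor_pos {t x : ℝ} (hx : x ∈ Set.Ioo (-(π / 2)) (π / 2)) (k : ℕ) :
    0 < ((((k : ℝ) + 1) - 1/2) ^ 2 * π ^ 2 + t ^ 2) /
      (((((k : ℝ) + 1) - 1/2) * π - x) * ((((k : ℝ) + 1) - 1/2) * π + x)) := by
  have hk : (0 : ℝ) ≤ k * π := by positivity
  have hpos : 0 < ((k : ℝ) + 1) - 1/2 := by linarith [(Nat.cast_nonneg k : (0 : ℝ) ≤ k)]
  refine div_pos (by positivity) (mul_pos ?_ ?_) <;> nlinarith [hx.1, hx.2]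

/-- Logarithmic Ramanujan identity for the Born–Infeld soliton height function:
for real `t` and `x ∈ (-π/2, π/2)`, the series with `k`-th term
`ln(((k - 1/2)²π² + t²) / (((k - 1/2)π - x)((k - 1/2)π + x)))` converges to
`ln (cosh t / cos x)`. -/
theorem born_infeld_log_series (t x : ℝ)
    (hx : x ∈ Set.Ioo (-(π / 2)) (π / 2)) :
    Tendsto
      (fun N : ℕ => ∑ k ∈ Finset.range N,
        Real.log (((((k : ℝ) + 1) - 1/2) ^ 2 * π ^ 2 + t ^ 2) /
          (((((k : ℝ) + 1) - 1/2) * π - x) * ((((k : ℝ) + 1) - 1/2) * π + x))))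
      atTop (𝓝 (Real.log (Real.cosh t / Real.cos x))) := by
  have hcos : 0 < Real.cos x := cos_pos_of_mem_Ioo hx
  have hx' : (x : ℂ) = 0 ∨ Complex.sin x ≠ 0 := by
    refine or_iff_not_imp_right.mpr fun h => ?_
    rw [not_not, ← Complex.ofReal_sin, Complex.ofReal_eq_zero,
      sin_eq_zero_iff_of_lt_of_lt (by linarith [hx.1, pi_pos]) (by linarith [hx.2, pi_pos])] at h
    exact_mod_cast h
  have ht' : (t : ℂ) * Complex.I = 0 ∨ Complex.sin (t * Complex.I) ≠ 0 := by
    refine or_iff_not_imp_right.mpr fun h => ?_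
    rw [not_not, Complex.sin_mul_I, mul_eq_zero, ← Complex.ofReal_sinh, Complex.ofReal_eq_zero,
      sinh_eq_zero] at h
    simpa using h
  have hquot := (tendsto_euler_cos_prod ht').div (tendsto_euler_cos_prod hx')
    (by rw [← Complex.ofReal_cos]; exact_mod_cast hcos.ne')
  rw [Complex.cos_mul_I, ← Complex.ofReal_cosh, ← Complex.ofReal_cos,
    ← Complex.ofReal_div (Real.cosh t)]
    at hquot
  have hprod : Tendsto (fun N : ℕ => ∏ k ∈ Finset.range N,
        (((((k : ℝ) + 1) - 1/2) ^ 2 * π ^ 2 + t ^ 2) /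
          (((((k : ℝ) + 1) - 1/2) * π - x) * ((((k : ℝ) + 1) - 1/2) * π + x))))
      atTop (𝓝 (Real.cosh t / Real.cos x)) := by
    rw [← Complex.ofReal_re (Real.cosh t / Real.cos x)]
    refine ((Complex.continuous_re.tendsto _).comp hquot).congr fun N => ?_
    rw [Function.comp_apply, Pi.div_apply, ← Finset.prod_div_distrib,
      ← Complex.ofReal_re (∏ k ∈ _, _), Complex.ofReal_prod]
    refine congrArg Complex.re (Finset.prod_congr rfl fun k _ => ?_)
    have hpos : (0 : ℝ) < k + 1 / 2 := by positivity
    have hreal : (((((k : ℝ) + 1) - 1/2) ^ 2 * π ^ 2 + t ^ 2) /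
          (((((k : ℝ) + 1) - 1/2) * π - x) * ((((k : ℝ) + 1) - 1/2) * π + x))) =
        (1 + (t / π) ^ 2 / (k + 1 / 2) ^ 2) / (1 - (x / π) ^ 2 / (k + 1 / 2) ^ 2) := by
      have hc : ((k : ℝ) + 1 / 2) ^ 2 * π ^ 2 ≠ 0 := by positivity
      rw [← mul_div_mul_left _ (1 - (x / π) ^ 2 / ((k : ℝ) + 1 / 2) ^ 2) hc,
        show ((k : ℝ) + 1) - 1 / 2 = k + 1 / 2 by ring]
      generalize (k : ℝ) + 1 / 2 = a at hpos
      congr 1 <;> field_simp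
      ring
    rw [hreal, mul_div_right_comm, mul_pow, Complex.I_sq]
    push_cast
    ring
  have hlog := hprod.log (div_pos (cosh_pos t) hcos).ne'
  exact hlog.congr fun N => log_prod fun k _ => (born_infeld_factor_pos hx k).ne'
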